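/- arXiv:2601.09553 — 3 statements merged into one kernel-verified Lean document; each statement's English description precedes it below -/
import Mathlib

section
/- Let X be a measurable space with a probability measure ν and let M be a standard Borel space. For measurable maps f, g : X → M, the pushforward of ν under x ↦ (x, f(x)) equals the pushforward of ν under x ↦ (x, g(x)) if and only if f(x) = g(x) for ν-almost every x. -/
open MeasureTheory

/-- Two measurable maps into a standard Borel space have equal graph joinings with respect
to a probability measure `ν` if and only if they agree `ν`-almost everywhere. -/
theorem graph_joining_eq_iff_ae_eq
    {X M : Type*} [MeasurableSpace X] [MeasurableSpace M] [StandardBorelSpace M]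
    (ν : Measure X) [IsProbabilityMeasure ν]
    (f g : X → M) (hf : Measurable f) (hg : Measurable g) :
    ν.map (fun x => (x, f x)) = ν.map (fun x => (x, g x)) ↔ f =ᵐ[ν] g := by
  let := upgradeStandardBorel M
  refine ⟨fun h => ?_, fun h => ?_⟩
  · have hE : MeasurableSet {p : X × M | f p.1 = p.2} :=
      measurableSet_eq_fun (hf.comp measurable_fst) measurable_snd
    have hae : ∀ᵐ p ∂ν.map (fun x => (x, f x)), f p.1 = p.2 :=
      (ae_map_iff (measurable_id.prodMk hf).aemeasurable hE).2 (ae_of_all _ fun _ => rfl)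
    rw [h] at hae
    exact ae_of_ae_map (measurable_id.prodMk hg).aemeasurable hae
  · refine Measure.map_congr ?_
    filter_upwards [h] with x hx
    rw [hx]
end

section
/- Let X and M be standard Borel spaces, let ν be a Borel probability measure on X, let T : X → X be a measurable bijection with measurable inverse that preserves ν, let S : M → M be measurable, let φ : X → M be measurable, and let λ be the pushforward of ν under x ↦ (x, φ(x)) (the graph joining of φ). Then the pushforward of λ under the product map (x, m) ↦ (T(x), S(m)) equals λ if and only if φ(T(x)) = S(φ(x)) for ν-almost every x. -/
open MeasureTheory

/-- Equivariance via graph joinings: let `T : X → X` be a measurable bijection with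
measurable inverse preserving the probability measure `ν`, let `S : M → M` be measurable
and let `λ` be the graph joining of a measurable `φ : X → M`. Then the pushforward of `λ`
under `(x, m) ↦ (T x, S m)` equals `λ` iff `φ (T x) = S (φ x)` for `ν`-a.e. `x`. -/
theorem graph_joining_invariant_iff_equivariant
    {X M : Type*} [MeasurableSpace X] [StandardBorelSpace X]
    [MeasurableSpace M] [StandardBorelSpace M]
    (ν : Measure X) [IsProbabilityMeasure ν]
    (T T' : X → X) (hT : Measurable T) (hT' : Measurable T')
    (hTT' : T ∘ T' = id) (hT'T : T' ∘ T = id)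
    (hTν : ν.map T = ν)
    (S : M → M) (hS : Measurable S)
    (φ : X → M) (hφ : Measurable φ)
    (lam : Measure (X × M)) (hlam : lam = ν.map (fun x => (x, φ x))) :
    lam.map (Prod.map T S) = lam ↔ (∀ᵐ x ∂ν, φ (T x) = S (φ x)) := by
  have hgraph : Measurable fun x => (x, φ x) := measurable_id.prodMk hφ
  have hmap : lam.map (Prod.map T S) = ν.map (fun x => (T x, S (φ x))) := by
    rw [hlam, Measure.map_map (hT.prodMap hS) hgraph]
    rfl
  constructor
  · intro h
    have hset : MeasurableSet {p : X × M | φ p.1 = p.2} :=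
      measurableSet_eq_fun (hφ.comp measurable_fst) measurable_snd
    have hae : ∀ᵐ p ∂lam, φ p.1 = p.2 := by
      rw [hlam, ae_map_iff hgraph.aemeasurable hset]
      exact ae_of_all _ fun _ => rfl
    rw [← h, hmap] at hae
    exact (ae_map_iff (hT.prodMk (hS.comp hφ)).aemeasurable hset).1 hae
  · intro h
    calc
      lam.map (Prod.map T S) = ν.map (fun x => (T x, S (φ x))) := hmap
      _ = ν.map ((fun x => (x, φ x)) ∘ T) :=
        Measure.map_congr (h.mono fun x hx => Prod.ext rfl hx.symm)
      _ = lam := by rw [← Measure.map_map hgraph hT, hTν, hlam]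
end

section
/- Let X and M be standard Borel spaces, where M is a Polish metric space with its Borel σ-algebra, let ν be a Borel probability measure on X and ρ a Borel probability measure on M. Then the set of Borel probability measures λ on X × M whose first marginal is ν, whose second marginal is ρ, and for which there exists a measurable map φ : X → M with λ equal to the pushforward of ν under x ↦ (x, φ(x)), is a measurable subset of ProbabilityMeasure(X × M). -/
open MeasureTheory

/-- The canonical measurable structure on the space of Borel probability measures,
inherited from the measurable space of measures (generated by the evaluation maps). -/
instance probabilityMeasureMeasurableSpace {Ω : Type*} [MeasurableSpace Ω] :
    MeasurableSpace (ProbabilityMeasure Ω) :=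
  inferInstanceAs (MeasurableSpace {μ : Measure Ω // IsProbabilityMeasure μ})

open ProbabilityTheory

/-- The set of parameters at which a Markov kernel into a countably generated space equals a fixed
probability measure is measurable. -/
lemma ProbabilityTheory.Kernel.measurableSet_apply_eq {α Ω : Type*} [MeasurableSpace α]
    [mΩ : MeasurableSpace Ω] [MeasurableSpace.CountablyGenerated Ω] (κ : Kernel α Ω)
    [IsMarkovKernel κ] (μ : Measure Ω) [IsProbabilityMeasure μ] :
    MeasurableSet {a | κ a = μ} := by
  set C := generateSetAlgebra (MeasurableSpace.countableGeneratingSet Ω)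
  have hC : C.Countable :=
    countable_generateSetAlgebra (MeasurableSpace.countable_countableGeneratingSet (α := Ω))
  have hgen : mΩ = MeasurableSpace.generateFrom C := by
    rw [generateFrom_generateSetAlgebra_eq, MeasurableSpace.generateFrom_countableGeneratingSet]
  have hpi : IsPiSystem C := fun s hs t ht _ => isSetAlgebra_generateSetAlgebra.inter_mem hs ht
  have heq : {a | κ a = μ} = ⋂ s ∈ C, {a | κ a s = μ s} := by
    ext a
    simp only [Set.mem_ofPred_eq, Set.mem_iInter]
    exact ⟨fun h s _ => by rw [h],
      fun h => ext_of_generate_finite C hgen hpi h (by simp)⟩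
  rw [heq]
  refine MeasurableSet.biInter hC fun s hs => ?_
  have hsm : MeasurableSet s := by
    rw [hgen]
    exact MeasurableSpace.measurableSet_generateFrom hs
  exact κ.measurable_coe hsm (measurableSet_singleton _)

/-- If a measure is concentrated on the graph of a measurable map, it is the pushforward of its
first marginal under the corresponding graph map. -/
lemma MeasureTheory.Measure.eq_map_graph_of_ae {X M : Type*} [MeasurableSpace X]
    [MeasurableSpace M] {ρ : Measure (X × M)} {φ : X → M} (hφ : Measurable φ)
    (h : ∀ᵐ p ∂ρ, p.2 = φ p.1) :
    ρ = (ρ.map Prod.fst).map (fun x => (x, φ x)) := by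
  rw [Measure.map_map (by fun_prop) measurable_fst]
  conv_lhs => rw [← Measure.map_id (μ := ρ)]
  refine Measure.map_congr ?_
  filter_upwards [h] with p hp
  exact Prod.ext rfl hp

/-- The measures of a Markov kernel into a product of standard Borel spaces which are the
pushforward of their first marginal under a measurable graph map form a measurable set. -/
lemma ProbabilityTheory.Kernel.measurableSet_exists_eq_map_graph {α X M : Type*}
    [MeasurableSpace α] [MeasurableSpace X] [MeasurableSpace.CountablyGenerated X]
    [MeasurableSpace M] [StandardBorelSpace M] [Nonempty M]
    (κ : Kernel α (X × M)) [IsMarkovKernel κ] :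
    MeasurableSet {a | ∃ φ : X → M, Measurable φ ∧
      κ a = ((κ a).map Prod.fst).map (fun x => (x, φ x))} := by
  set g := embeddingReal M
  have hg : MeasurableEmbedding g := measurableEmbedding_embeddingReal M
  set m : α × X → ℝ := fun p => ∫ y, g y ∂(κ.condKernel p)
  have hm : Measurable m :=
    (StronglyMeasurable.integral_kernel hg.measurable.stronglyMeasurable).measurable
  have hS : MeasurableSet {q : α × (X × M) | g q.2.2 ≠ m (q.1, q.2.1)} :=
    (measurableSet_eq_fun (by fun_prop) (by fun_prop)).compl
  convert Kernel.measurable_kernel_prodMk_left (κ := κ) hS (measurableSet_singleton 0) using 1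
  ext a
  have hma : Measurable fun x => m (a, x) := by fun_prop
  simp only [Set.mem_ofPred_eq, Set.mem_preimage, Set.mem_singleton_iff]
  change _ ↔ ∀ᵐ p ∂(κ a), g p.2 = m (a, p.1)
  constructor
  · rintro ⟨φ, hφ, h⟩
    have hae : ∀ᵐ p ∂(κ a), g p.2 = g (φ p.1) := by
      rw [h, ae_map_iff (by fun_prop)
        (measurableSet_eq_fun (by fun_prop) (by fun_prop))]
      simp
    have hae' : ∀ᵐ x ∂(κ.fst a), ∀ᵐ y ∂(κ.condKernel (a, x)), g y = g (φ x) := by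
      apply Kernel.ae_ae_of_ae_compProd (p := fun p => g p.2 = g (φ p.1))
      rwa [κ.disintegrate κ.condKernel]
    have hmean : ∀ᵐ x ∂(κ.fst a), m (a, x) = g (φ x) := by
      filter_upwards [hae'] with x hx
      simp [m, integral_congr_ae hx]
    rw [Kernel.fst_apply] at hmean
    filter_upwards [hae, ae_of_ae_map (by fun_prop) hmean] with p h₁ h₂
    rw [h₁, h₂]
  · intro h
    refine ⟨fun x => hg.invFun (m (a, x)), hg.measurable_invFun.comp hma,
      Measure.eq_map_graph_of_ae (hg.measurable_invFun.comp hma) ?_⟩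
    filter_upwards [h] with p hp
    rw [← hp, hg.leftInverse_invFun]

/-- The set of graph joinings with prescribed marginals is measurable: for `X` standard
Borel, `M` Polish metric, `ν` a Borel probability measure on `X` and `ρ` a Borel
probability measure on `M`, the set of probability measures `λ` on `X × M` with first
marginal `ν`, second marginal `ρ`, and supported on the graph of a measurable map
`φ : X → M` (i.e. `λ = (x ↦ (x, φ x))_* ν`), is a measurable subset of
`ProbabilityMeasure (X × M)`. -/
theorem measurableSet_graph_joinings
    {X M : Type*} [MeasurableSpace X] [StandardBorelSpace X]
    [MetricSpace M] [PolishSpace M] [MeasurableSpace M] [BorelSpace M]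
    (ν : Measure X) [IsProbabilityMeasure ν]
    (ρ : Measure M) [IsProbabilityMeasure ρ] :
    MeasurableSet {lam : ProbabilityMeasure (X × M) |
      (lam : Measure (X × M)).map Prod.fst = ν ∧
      (lam : Measure (X × M)).map Prod.snd = ρ ∧
      ∃ φ : X → M, Measurable φ ∧
        (lam : Measure (X × M)) = ν.map (fun x => (x, φ x))} := by
  have : Nonempty M := nonempty_of_isProbabilityMeasure ρ
  let κ : Kernel (ProbabilityMeasure (X × M)) (X × M) := ⟨fun lam => lam, measurable_subtype_coe⟩
  have : IsMarkovKernel κ := ⟨fun lam => lam.2⟩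
  have : IsMarkovKernel (κ.map Prod.fst) := Kernel.IsMarkovKernel.map κ measurable_fst
  have : IsMarkovKernel (κ.map Prod.snd) := Kernel.IsMarkovKernel.map κ measurable_snd
  convert ((κ.map Prod.fst).measurableSet_apply_eq ν).inter
    (((κ.map Prod.snd).measurableSet_apply_eq ρ).inter κ.measurableSet_exists_eq_map_graph) using 1
  ext lam
  simp only [Set.mem_inter_iff, Set.mem_ofPred_eq, Kernel.map_apply _ measurable_fst,
    Kernel.map_apply _ measurable_snd]
  refine and_congr_right fun hν => and_congr_right fun _ => ?_
  change _ ↔ ∃ φ : X → M, Measurable φ ∧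
    (lam : Measure (X × M)) = ((lam : Measure (X × M)).map Prod.fst).map (fun x => (x, φ x))
  rw [hν]
end
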